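/- Let G be a connected δ-regular finite simple graph on n vertices with adjacency matrix A that is k-partially walk-regular for some k ≥ 1. Let p be a real polynomial of degree at most k such that p(δ) = 1 and p(θ) ≥ 0 for every eigenvalue θ of A. Then the k-independence number satisfies α_k(G) ≤ trace( p(A) ). -/

import Mathlib

open Polynomial Matrix

/-- The `k`-independence number of a graph: the maximum size of a set of vertices
such that no walk of length at most `k` joins two distinct vertices of the set
(equivalently, pairwise distance greater than `k`). -/
noncomputable def kIndepNum {V : Type*} (G : SimpleGraph V) (k : ℕ) : ℕ :=
  sSup {m | ∃ S : Finset V, S.card = m ∧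
    ∀ u ∈ S, ∀ v ∈ S, u ≠ v → ∀ w : G.Walk u v, k < w.length}

/-- A real polynomial that is nonnegative on the spectrum of a real symmetric matrix evaluates
to a positive semidefinite matrix. -/
theorem posSemidef_aeval_of_nonneg_on_spectrum {V : Type*} [Fintype V] [DecidableEq V]
    {A : Matrix V V ℝ} (hA : A.IsHermitian) (p : Polynomial ℝ)
    (hp : ∀ θ ∈ spectrum ℝ A, 0 ≤ p.eval θ) : (aeval A p).PosSemidef := by
  have hA' : IsSelfAdjoint A := hA
  rw [← cfc_polynomial p A hA', Matrix.posSemidef_iff_isHermitian_and_spectrum_nonneg]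
  refine ⟨cfc_predicate (R := ℝ) (p := IsSelfAdjoint) p.eval A, ?_⟩
  rw [cfc_map_spectrum (R := ℝ) p.eval A hA' p.continuous.continuousOn]
  rintro _ ⟨θ, hθ, rfl⟩
  exact hp θ hθ

/-- An entry of `p(A)` is the corresponding combination of the entries of powers of `A`. -/
theorem aeval_matrix_apply {V : Type*} [Fintype V] [DecidableEq V]
    (A : Matrix V V ℝ) (p : Polynomial ℝ) (u v : V) :
    aeval A p u v = ∑ l ∈ Finset.range (p.natDegree + 1), p.coeff l * (A ^ l) u v := by
  simp [aeval_eq_sum_range, Matrix.sum_apply]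

/-- A polynomial in `A` maps an eigenvector of `A` to its multiple by the value of the
polynomial at the eigenvalue. -/
theorem aeval_mulVec_of_mulVec_eq_smul {V : Type*} [Fintype V] [DecidableEq V]
    {A : Matrix V V ℝ} {x : V → ℝ} {μ : ℝ} (h : A *ᵥ x = μ • x) (p : Polynomial ℝ) :
    aeval A p *ᵥ x = p.eval μ • x := by
  have hpow (l : ℕ) : A ^ l *ᵥ x = μ ^ l • x := by
    induction l with
    | zero => simp
    | succ l ih => rw [pow_succ, ← mulVec_mulVec, h, mulVec_smul, ih, smul_smul, pow_succ']
  simp [aeval_eq_sum_range, eval_eq_sum_range, Matrix.sum_mulVec, Finset.sum_smul,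
    smul_mulVec, hpow, smul_smul]

/-- A positive semidefinite matrix with constant diagonal and row sums `1` has trace at least the
size of any set of indices on which it is diagonal. -/
theorem card_le_trace_of_posSemidef {V : Type*} [Fintype V] [DecidableEq V]
    {M : Matrix V V ℝ} (hM : M.PosSemidef) (hone : M *ᵥ 1 = 1)
    (hdiag : ∀ u v, M u u = M v v) (S : Finset V)
    (hS : ∀ u ∈ S, ∀ v ∈ S, u ≠ v → M u v = 0) : (S.card : ℝ) ≤ M.trace := by
  rcases S.eq_empty_or_nonempty with rfl | ⟨a, ha⟩
  · rw [Finset.card_empty, Nat.cast_zero]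
    exact hM.trace_nonneg
  have hs : (0 : ℝ) < S.card := by exact_mod_cast Finset.card_pos.mpr ⟨a, ha⟩
  have hn : (0 : ℝ) < Fintype.card V := by exact_mod_cast Fintype.card_pos_iff.mpr ⟨a⟩
  set s : ℝ := (S.card : ℝ)
  set n : ℝ := (Fintype.card V : ℝ)
  have htr : M.trace = n * M a a := by
    simp [Matrix.trace, fun u => hdiag u a, n]
  let y : V → ℝ := fun u => if u ∈ S then 1 else 0
  have hMt : Mᵀ = M := by simpa using hM.isHermitian.eq
  have hy1 : y ⬝ᵥ 1 = s := by simp [y, dotProduct, s]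
  have h11 : (1 : V → ℝ) ⬝ᵥ 1 = n := by simp [n]
  have h1y : (1 : V → ℝ) ⬝ᵥ M *ᵥ y = s := by
    rw [dotProduct_mulVec, ← mulVec_transpose, hMt, hone, dotProduct_comm, hy1]
  have hyy : y ⬝ᵥ M *ᵥ y = s * M a a := by
    have hrow : ∀ u ∈ S, (M *ᵥ y) u = M a a := by
      intro u hu
      simp only [mulVec, dotProduct, y, mul_ite, mul_one, mul_zero, Finset.sum_ite_mem,
        Finset.univ_inter]
      rw [Finset.sum_eq_single_of_mem u hu fun v hv hvu => hS u hu v hv hvu.symm, hdiag u a]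
    simp only [dotProduct, y, ite_mul, one_mul, zero_mul, Finset.sum_ite_mem, Finset.univ_inter]
    rw [Finset.sum_congr rfl hrow]
    simp [s]
  have hq : 0 ≤ (n • y - s • (1 : V → ℝ)) ⬝ᵥ M *ᵥ (n • y - s • (1 : V → ℝ)) := by
    simpa using hM.dotProduct_mulVec_nonneg (n • y - s • (1 : V → ℝ))
  simp only [mulVec_sub, mulVec_smul, hone, sub_dotProduct, dotProduct_sub, smul_dotProduct,
    dotProduct_smul, smul_eq_mul, hy1, h11, h1y, hyy] at hq
  rw [htr]
  have hprod : 0 ≤ (n * s) * (n * M a a - s) := by linarith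
  linarith [nonneg_of_mul_nonneg_right hprod (mul_pos hn hs)]

/-- The supremum defining the `k`-independence number of a finite graph is attained. -/
theorem exists_card_eq_kIndepNum {V : Type*} [Fintype V] (G : SimpleGraph V) (k : ℕ) :
    ∃ S : Finset V, S.card = kIndepNum G k ∧
      ∀ u ∈ S, ∀ v ∈ S, u ≠ v → ∀ w : G.Walk u v, k < w.length := by
  refine Nat.sSup_mem (s := {m | ∃ S : Finset V, S.card = m ∧
    ∀ u ∈ S, ∀ v ∈ S, u ≠ v → ∀ w : G.Walk u v, k < w.length}) ⟨0, ∅, by simp⟩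
    ⟨Fintype.card V, ?_⟩
  rintro _ ⟨S, rfl, -⟩
  exact S.card_le_univ

/-- Main theorem: for a k-partially walk-regular graph, the k-independence number
is at most the trace of p(A), for any polynomial p of degree at most k with
p(δ) = 1 and p nonnegative on the spectrum. -/
theorem kIndep_le_trace {n : ℕ} (G : SimpleGraph (Fin n)) [DecidableRel G.Adj]
    (hconn : G.Connected) (δ : ℕ) (hreg : G.IsRegularOfDegree δ)
    (k : ℕ) (hk : 1 ≤ k)
    (hwalkreg : ∀ l ≤ k, ∀ u v : Fin n,
      ((G.adjMatrix ℝ) ^ l) u u = ((G.adjMatrix ℝ) ^ l) v v)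
    (p : Polynomial ℝ) (hdeg : p.natDegree ≤ k)
    (hpδ : p.eval (δ : ℝ) = 1)
    (hpos : ∀ θ ∈ spectrum ℝ (G.adjMatrix ℝ), 0 ≤ p.eval θ) :
    (kIndepNum G k : ℝ) ≤ Matrix.trace (Polynomial.aeval (G.adjMatrix ℝ) p) := by
  obtain ⟨S, hcard, hS⟩ := exists_card_eq_kIndepNum G k
  rw [← hcard]
  have hA : (G.adjMatrix ℝ).IsHermitian := by
    rw [Matrix.IsHermitian, conjTranspose_eq_transpose_of_trivial, SimpleGraph.transpose_adjMatrix]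
  refine card_le_trace_of_posSemidef (posSemidef_aeval_of_nonneg_on_spectrum hA p hpos) ?_ ?_ S ?_
  · have h : G.adjMatrix ℝ *ᵥ 1 = (δ : ℝ) • 1 := by
      ext u
      simp [SimpleGraph.adjMatrix_mulVec_apply, hreg.degree_eq u]
    rw [aeval_mulVec_of_mulVec_eq_smul h, hpδ, one_smul]
  · intro u v
    simp only [aeval_matrix_apply]
    refine Finset.sum_congr rfl fun l hl => ?_
    rw [hwalkreg l (by grind) u v]
  · intro u hu v hv huv
    rw [aeval_matrix_apply]
    refine Finset.sum_eq_zero fun l hl => ?_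
    rw [SimpleGraph.adjMatrix_pow_apply_eq_card_walk, mul_eq_zero]
    right
    rw [Nat.cast_eq_zero, Fintype.card_eq_zero_iff]
    refine ⟨fun ⟨w, hw⟩ => ?_⟩
    have := hS u hu v hv huv w
    simp at hw
    grind
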